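/- Let T be a d-angulation of a convex n-gon and let i, j be distinct vertices lying on a common d-gon of T. Then the number of d-paths from i to j equals 1, i.e., m_{i,j} = 1. -/

import Mathlib

noncomputable section

/-- The `k`-th vertex of a regular `n`-gon inscribed in the unit circle. -/
def vtx (n : ℕ) (k : ZMod n) : ℝ × ℝ :=
  (Real.cos (2 * Real.pi * k.val / n), Real.sin (2 * Real.pi * k.val / n))

/-- The convex hull spanned by a set `c` of vertices of the `n`-gon. -/
def cellHull (n : ℕ) (c : Finset (ZMod n)) : Set (ℝ × ℝ) :=
  convexHull ℝ (vtx n '' (c : Set (ZMod n)))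

/-- `T` is a `d`-angulation of the convex `n`-gon: a dissection of the polygon by
pairwise non-crossing diagonals into `d`-gon cells.  Each cell is recorded by its
vertex set; the cells cover the polygon and have pairwise disjoint interiors. -/
def IsDAngulation (n d : ℕ) (T : Finset (Finset (ZMod n))) : Prop :=
  (∀ c ∈ T, c.card = d) ∧
  (⋃ c ∈ T, cellHull n c) = convexHull ℝ (Set.range (vtx n)) ∧
  ∀ c ∈ T, ∀ c' ∈ T, c ≠ c' →
    interior (cellHull n c) ∩ interior (cellHull n c') = ∅

/-- The number of vertices strictly between `i` and `j`, going counterclockwise. -/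
def pathLen (n : ℕ) (i j : ZMod n) : ℕ := (j - i - 1).val

/-- A (counterclockwise) `d`-path from `i` to `j` in the `d`-angulation `T`:
a sequence `p_{i+1}, …, p_{j-1}` of cells of `T`, indexed by the vertices
encountered going counterclockwise from `i` to `j`, such that the cell at
position `k` is incident to the vertex `i+1+k`, and each cell of `T` occurs
at most `d - 2` times in the sequence. -/
def IsDPath (n d : ℕ) (T : Finset (Finset (ZMod n))) (i j : ZMod n)
    (q : Fin (pathLen n i j) → {c // c ∈ T}) : Prop :=
  (∀ k, (i + 1 + ((k : ℕ) : ZMod n)) ∈ (q k : Finset (ZMod n))) ∧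
  ∀ c ∈ T, (Finset.univ.filter (fun k => (q k : Finset (ZMod n)) = c)).card ≤ d - 2

/-- The number `m_{i,j}` of counterclockwise `d`-paths from `i` to `j`. -/
def dPathCount (n d : ℕ) (T : Finset (Finset (ZMod n))) (i j : ZMod n) : ℕ :=
  Nat.card {q : Fin (pathLen n i j) → {c // c ∈ T} // IsDPath n d T i j q}

/-- Twice the signed area of the triangle `a b c`. -/
def orient (a b c : ℝ × ℝ) : ℝ :=
  (b.1 - a.1) * (c.2 - a.2) - (b.2 - a.2) * (c.1 - a.1)

/-- The position of `v` in the counterclockwise enumeration of the vertices starting at `i`. -/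
def pos {n : ℕ} (i v : ZMod n) : ℕ := (v - i).val

lemma orient_circle (x y z : ℝ) :
    orient (Real.cos x, Real.sin x) (Real.cos y, Real.sin y) (Real.cos z, Real.sin z) =
      4 * Real.sin ((y - x) / 2) * Real.sin ((z - y) / 2) * Real.sin ((z - x) / 2) := by
  have expand : orient (Real.cos x, Real.sin x) (Real.cos y, Real.sin y)
      (Real.cos z, Real.sin z) = Real.sin (y - x) + Real.sin (z - y) - Real.sin (z - x) := by
    simp only [orient, Real.sin_sub]
    ring
  obtain ⟨A, hA⟩ : ∃ A, A = (y - x) / 2 := ⟨_, rfl⟩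
  obtain ⟨B, hB⟩ : ∃ B, B = (z - y) / 2 := ⟨_, rfl⟩
  rw [expand, ← hA, ← hB, show y - x = 2 * A by linarith, show z - y = 2 * B by linarith,
    show z - x = 2 * A + 2 * B by linarith, show (2 * A + 2 * B) / 2 = A + B by ring,
    Real.sin_add, Real.sin_add, Real.sin_two_mul, Real.sin_two_mul, Real.cos_two_mul,
    Real.cos_two_mul, Real.cos_sq', Real.cos_sq']
  ring

lemma vtx_eq_of_pos {n : ℕ} [NeZero n] (i v : ZMod n) :
    vtx n v = (Real.cos (2 * Real.pi * (pos i v + i.val) / n),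
      Real.sin (2 * Real.pi * (pos i v + i.val) / n)) := by
  have hn : (n : ℝ) ≠ 0 := Nat.cast_ne_zero.mpr (NeZero.ne n)
  have hval : v.val = (pos i v + i.val) % n := by
    rw [pos, ← ZMod.val_add, sub_add_cancel]
  have hdiv : (v.val : ℝ) + n * ((pos i v + i.val) / n : ℕ) = pos i v + i.val := by
    rw [hval]
    exact_mod_cast Nat.mod_add_div _ _
  have hangle : 2 * Real.pi * (v.val : ℝ) / n =
      2 * Real.pi * (pos i v + i.val) / n -
        ((pos i v + i.val) / n : ℕ) * (2 * Real.pi) := by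
    rw [← hdiv]
    field_simp
    ring
  rw [vtx, hangle, Real.cos_sub_nat_mul_two_pi, Real.sin_sub_nat_mul_two_pi]

lemma orient_vtx_pos {n : ℕ} [NeZero n] {i a b c : ZMod n}
    (hab : pos i a < pos i b) (hbc : pos i b < pos i c) :
    0 < orient (vtx n a) (vtx n b) (vtx n c) := by
  have hn : (0 : ℝ) < n := Nat.cast_pos.mpr (NeZero.pos n)
  have hsin : ∀ u v : ZMod n, pos i u < pos i v →
      0 < Real.sin ((2 * Real.pi * (pos i v + i.val) / n -
        2 * Real.pi * (pos i u + i.val) / n) / 2) := by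
    intro u v huv
    have hvn : (pos i v : ℝ) < n := by exact_mod_cast ZMod.val_lt (v - i)
    have huv' : (pos i u : ℝ) < pos i v := by exact_mod_cast huv
    have hu : (0 : ℝ) ≤ pos i u := Nat.cast_nonneg _
    have hangle : (2 * Real.pi * (pos i v + i.val) / n -
        2 * Real.pi * (pos i u + i.val) / n) / 2 =
        Real.pi * ((pos i v - pos i u) / n) := by
      field_simp
      ring
    rw [hangle]
    apply Real.sin_pos_of_pos_of_lt_pi
    · exact mul_pos Real.pi_pos (div_pos (by linarith) hn)
    · have : ((pos i v : ℝ) - pos i u) / n < 1 := by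
        rw [div_lt_one hn]
        linarith
      nlinarith [Real.pi_pos]
  rw [vtx_eq_of_pos i a, vtx_eq_of_pos i b, vtx_eq_of_pos i c, orient_circle]
  have := hsin a b hab
  have := hsin b c hbc
  have := hsin a c (hab.trans hbc)
  positivity

lemma orient_rotate (a b c : ℝ × ℝ) : orient b c a = orient a b c := by
  simp only [orient]
  ring

lemma affineSpan_eq_top_of_orient_ne_zero {s : Set (ℝ × ℝ)} {a b c : ℝ × ℝ}
    (ha : a ∈ s) (hb : b ∈ s) (hc : c ∈ s) (h : orient a b c ≠ 0) :
    affineSpan ℝ s = ⊤ := by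
  rw [eq_top_iff]
  intro p _
  have ha' := subset_affineSpan ℝ s ha
  have hb' := subset_affineSpan ℝ s hb
  have hc' := subset_affineSpan ℝ s hc
  have hmem := AffineSubspace.smul_vsub_vadd_mem _ (orient a b p / orient a b c) hc' ha'
    (AffineSubspace.smul_vsub_vadd_mem _ (orient a p c / orient a b c) hb' ha' ha')
  convert hmem using 1
  ext
  · simp
    field_simp
    simp only [orient]
    ring
  · simp
    field_simp
    simp only [orient]
    ring

/-- A nonzero linear form is not constant on a nondegenerate triangle. -/
lemma linear_eq_zero_of_orient_ne_zero {f : ℝ × ℝ →L[ℝ] ℝ} {a b c : ℝ × ℝ}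
    (h : orient a b c ≠ 0) (hab : f b = f a) (hac : f c = f a) : f = 0 := by
  have hf : ∀ p : ℝ × ℝ, f p = p.1 * f (1, 0) + p.2 * f (0, 1) := by
    intro p
    rw [← smul_eq_mul, ← smul_eq_mul, ← map_smul, ← map_smul, ← map_add]
    congr 1
    ext <;> simp
  rw [hf b, hf a] at hab
  rw [hf c, hf a] at hac
  have h1 : f (1, 0) = 0 := by
    apply (mul_eq_zero.mp _).resolve_left h
    simp only [orient]
    linear_combination (c.2 - a.2) * hab - (b.2 - a.2) * hac
  have h2 : f (0, 1) = 0 := by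
    apply (mul_eq_zero.mp _).resolve_left h
    simp only [orient]
    linear_combination (b.1 - a.1) * hac - (c.1 - a.1) * hab
  ext <;> simp [h1, h2]

/-- The affine dependence between four points of the plane, evaluated by a linear form. -/
lemma orient_four_point (f : ℝ × ℝ →L[ℝ] ℝ) (a x b y : ℝ × ℝ) :
    orient x b y * f a + orient a x y * f b = orient a b y * f x + orient a x b * f y := by
  rw [← smul_eq_mul, ← smul_eq_mul, ← smul_eq_mul, ← smul_eq_mul, ← map_smul, ← map_smul,
    ← map_smul, ← map_smul, ← map_add, ← map_add]
  congr 1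
  ext <;> simp [orient] <;> ring

lemma exists_separating {s t : Set (ℝ × ℝ)} (hs : (interior (convexHull ℝ s)).Nonempty)
    (ht : (interior (convexHull ℝ t)).Nonempty)
    (hst : interior (convexHull ℝ s) ∩ interior (convexHull ℝ t) = ∅) :
    ∃ (f : ℝ × ℝ →L[ℝ] ℝ) (u : ℝ), f ≠ 0 ∧ (∀ p ∈ s, f p ≤ u) ∧ ∀ p ∈ t, u ≤ f p := by
  obtain ⟨f, u, hfs, hft⟩ := geometric_hahn_banach_open_open
    (convex_convexHull ℝ s).interior isOpen_interior
    (convex_convexHull ℝ t).interior isOpen_interior (Set.disjoint_iff_inter_eq_empty.mpr hst)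
  have hclosure : ∀ r : Set (ℝ × ℝ), (interior (convexHull ℝ r)).Nonempty →
      r ⊆ closure (interior (convexHull ℝ r)) := by
    intro r hr
    rw [(convex_convexHull ℝ r).closure_interior_eq_closure_of_nonempty_interior hr]
    exact (subset_convexHull ℝ r).trans subset_closure
  refine ⟨f, u, ?_, fun p hp => ?_, fun p hp => ?_⟩
  · rintro rfl
    obtain ⟨p, hp⟩ := hs
    obtain ⟨q, hq⟩ := ht
    have := hfs p hp
    have := hft q hq
    simp at *
    linarith
  · exact closure_minimal (fun q hq => (hfs q hq).le)
      (isClosed_le f.continuous continuous_const) (hclosure s hs hp)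
  · exact closure_minimal (fun q hq => (hft q hq).le)
      (isClosed_le continuous_const f.continuous) (hclosure t ht hp)

lemma orient_combination (u v p q r : ℝ × ℝ) {w₀ w₁ w₂ : ℝ} (h : w₀ + w₁ + w₂ = 1) :
    orient u v (w₀ • p + w₁ • q + w₂ • r) =
      w₀ * orient u v p + w₁ * orient u v q + w₂ * orient u v r := by
  obtain rfl : w₀ = 1 - w₁ - w₂ := by linarith
  simp [orient]
  ring

lemma orient_nonneg_of_mem_cellHull {n : ℕ} {c : Finset (ZMod n)} {u v p : ℝ × ℝ}
    (h : ∀ w ∈ c, 0 ≤ orient u v (vtx n w)) (hp : p ∈ cellHull n c) : 0 ≤ orient u v p := by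
  have hconvex : Convex ℝ {p | 0 ≤ orient u v p} := by
    intro x hx y hy a b ha hb hab
    have hcomb := orient_combination u v x y y (w₀ := a) (w₁ := b) (w₂ := 0) (by linarith)
    simp only [zero_smul, add_zero, zero_mul] at hcomb
    rw [Set.mem_ofPred_eq, hcomb]
    exact add_nonneg (mul_nonneg ha hx) (mul_nonneg hb hy)
  refine convexHull_min ?_ hconvex hp
  rintro _ ⟨w, hw, rfl⟩
  exact h w hw

section Position

variable {n : ℕ} {i : ZMod n}

lemma pos_add_natCast (i : ZMod n) {k : ℕ} (hk : k < n) : pos i (i + k) = k := by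
  rw [pos, add_sub_cancel_left, ZMod.val_cast_of_lt hk]

/-- The members of `c` that are neither first nor last in the enumeration starting at `i`. -/
def innerVertices (i : ZMod n) (c : Finset (ZMod n)) : Finset (ZMod n) :=
  {v ∈ c | (∃ a ∈ c, pos i a < pos i v) ∧ ∃ b ∈ c, pos i v < pos i b}

lemma mem_innerVertices {c : Finset (ZMod n)} {v : ZMod n} :
    v ∈ innerVertices i c ↔
      v ∈ c ∧ (∃ a ∈ c, pos i a < pos i v) ∧ ∃ b ∈ c, pos i v < pos i b := by
  simp [innerVertices]

/-- The largest difference of positions between two members of `c`. -/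
def width (i : ZMod n) (c : Finset (ZMod n)) : ℕ :=
  (c ×ˢ c).sup fun p => pos i p.2 - pos i p.1

lemma le_width {c : Finset (ZMod n)} {a b : ZMod n} (ha : a ∈ c) (hb : b ∈ c) :
    pos i b - pos i a ≤ width i c :=
  Finset.le_sup (f := fun p : ZMod n × ZMod n => pos i p.2 - pos i p.1)
    (Finset.mk_mem_product ha hb)

/-- In the enumeration starting at `i`, distinct members of `T` do not cross and share at most
two vertices, and every vertex but the first and the last is inner for some member of `T`. -/
structure IsNoncrossingCover (i : ZMod n) (T : Finset (Finset (ZMod n))) : Prop where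
  not_cross : ∀ c ∈ T, ∀ c' ∈ T, c ≠ c' → ∀ a ∈ c, ∀ b ∈ c, ∀ x ∈ c', ∀ y ∈ c',
    pos i a < pos i x → pos i x < pos i b → pos i b < pos i y → False
  not_share : ∀ c ∈ T, ∀ c' ∈ T, c ≠ c' → ∀ a ∈ c, ∀ b ∈ c, ∀ e ∈ c, a ∈ c' → b ∈ c' → e ∈ c' →
    pos i a < pos i b → pos i b < pos i e → False
  exists_inner : ∀ v, 0 < pos i v → pos i v + 1 < n → ∃ c ∈ T, v ∈ innerVertices i c

/-- A member of `T` meeting the open arc cut off by two vertices of another member lies in the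
closed arc. -/
lemma IsNoncrossingCover.pos_le_of_common_cell {T : Finset (Finset (ZMod n))}
    (H : IsNoncrossingCover i T) {c c' : Finset (ZMod n)} (hc : c ∈ T) (hc' : c' ∈ T)
    (hne : c' ≠ c) {j u v : ZMod n} (hi : i ∈ c) (hj : j ∈ c) (hv : v ∈ c') (hv0 : 0 < pos i v)
    (hvj : pos i v < pos i j) (hu : u ∈ c') : pos i u ≤ pos i j := by
  by_contra! h
  exact H.not_cross c hc c' hc' hne.symm i hi j hj v hv u hu (by simpa [pos] using hv0) hvj h

variable [NeZero n]

lemma pos_injective (i : ZMod n) : Function.Injective (pos i) := fun u v h => by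
  simpa using ZMod.val_injective n h

lemma orient_vtx_nonneg {a b c : ZMod n}
    (hab : pos i a ≤ pos i b) (hbc : pos i b ≤ pos i c) :
    0 ≤ orient (vtx n a) (vtx n b) (vtx n c) := by
  rcases hab.eq_or_lt with h | h
  · simp [pos_injective i h, orient]
  rcases hbc.eq_or_lt with h' | h'
  · rw [pos_injective i h', orient]
    linarith
  · exact (orient_vtx_pos h h').le

lemma card_innerVertices {c : Finset (ZMod n)} (hc : 2 ≤ c.card) :
    (innerVertices i c).card = c.card - 2 := by
  have hne : c.Nonempty := Finset.card_pos.mp (by omega)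
  obtain ⟨a, ha, hmin⟩ := Finset.exists_min_image c (pos i) hne
  obtain ⟨b, hb, hmax⟩ := Finset.exists_max_image c (pos i) hne
  have hab : b ≠ a := by
    rintro rfl
    have hsingle : c ⊆ {b} := fun x hx => by
      rw [Finset.mem_singleton]
      exact pos_injective i (le_antisymm (hmax x hx) (hmin x hx))
    have := Finset.card_le_card hsingle
    simp at this
    omega
  have heq : innerVertices i c = (c.erase a).erase b := by
    ext v
    rw [mem_innerVertices, Finset.mem_erase, Finset.mem_erase]
    constructor
    · rintro ⟨hv, ⟨x, hx, hxv⟩, y, hy, hvy⟩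
      refine ⟨?_, ?_, hv⟩
      · rintro rfl
        exact (hmax y hy).not_gt hvy
      · rintro rfl
        exact (hmin x hx).not_gt hxv
    · rintro ⟨hvb, hva, hv⟩
      exact ⟨hv, ⟨a, ha, (hmin v hv).lt_of_ne fun h => hva (pos_injective i h).symm⟩,
        b, hb, (hmax v hv).lt_of_ne fun h => hvb (pos_injective i h)⟩
  rw [heq, Finset.card_erase_of_mem (Finset.mem_erase.mpr ⟨hab, hb⟩),
    Finset.card_erase_of_mem ha]
  omega

lemma interior_cellHull_nonempty {c : Finset (ZMod n)} (hc : 3 ≤ c.card) :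
    (interior (cellHull n c)).Nonempty := by
  have hcard : 0 < (innerVertices (0 : ZMod n) c).card := by
    rw [card_innerVertices (by omega)]
    omega
  obtain ⟨v, hv⟩ := Finset.card_pos.mp hcard
  obtain ⟨hv, ⟨a, ha, hav⟩, b, hb, hvb⟩ := mem_innerVertices.mp hv
  exact interior_convexHull_nonempty_iff_affineSpan_eq_top.mpr
    (affineSpan_eq_top_of_orient_ne_zero (Set.mem_image_of_mem _ ha) (Set.mem_image_of_mem _ hv)
      (Set.mem_image_of_mem _ hb) (orient_vtx_pos hav hvb).ne')

lemma exists_separating_cells {d : ℕ} (hd : 3 ≤ d) {T : Finset (Finset (ZMod n))}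
    (hT : IsDAngulation n d T) {c c' : Finset (ZMod n)} (hc : c ∈ T) (hc' : c' ∈ T)
    (hne : c ≠ c') :
    ∃ (f : ℝ × ℝ →L[ℝ] ℝ) (u : ℝ), f ≠ 0 ∧ (∀ v ∈ c, f (vtx n v) ≤ u) ∧
      ∀ v ∈ c', u ≤ f (vtx n v) := by
  obtain ⟨f, u, hf, hfc, hfc'⟩ := exists_separating
    (interior_cellHull_nonempty (by rw [hT.1 c hc]; exact hd))
    (interior_cellHull_nonempty (by rw [hT.1 c' hc']; exact hd)) (hT.2.2 c hc c' hc' hne)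
  exact ⟨f, u, hf, fun v hv => hfc _ (Set.mem_image_of_mem _ hv),
    fun v hv => hfc' _ (Set.mem_image_of_mem _ hv)⟩

lemma exists_inner_of_cover {T : Finset (Finset (ZMod n))}
    (hT : (⋃ c ∈ T, cellHull n c) = convexHull ℝ (Set.range (vtx n)))
    {v : ZMod n} (h0 : 0 < pos i v) (h1 : pos i v + 1 < n) :
    ∃ c ∈ T, v ∈ innerVertices i c := by
  obtain ⟨s, hs⟩ : ∃ s : ZMod n, pos i s = 0 := ⟨i, by simp [pos]⟩
  obtain ⟨e, he⟩ : ∃ e : ZMod n, pos i e = n - 1 := ⟨_, pos_add_natCast i (by omega)⟩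
  obtain ⟨l, hl⟩ : ∃ l : ZMod n, pos i l = pos i v - 1 := ⟨_, pos_add_natCast i (by omega)⟩
  obtain ⟨r, hr⟩ : ∃ r : ZMod n, pos i r = pos i v + 1 := ⟨_, pos_add_natCast i h1⟩
  have hlast : ∀ w, pos i w ≤ n - 1 := fun w => Nat.le_sub_one_of_lt (ZMod.val_lt (w - i))
  have hA : 0 < orient (vtx n l) (vtx n v) (vtx n r) :=
    orient_vtx_pos (i := i) (by omega) (by omega)
  have hout : ∀ w, w ≠ v → 0 ≤ orient (vtx n l) (vtx n r) (vtx n w) := by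
    intro w hw
    have : pos i w ≠ pos i v := fun h => hw (pos_injective i h)
    rcases Nat.lt_or_gt_of_ne this with h | h
    · rw [orient_rotate]
      exact orient_vtx_nonneg (i := i) (by omega) (by omega)
    · exact orient_vtx_nonneg (i := i) (by omega) (by omega)
  have hS := hout s (by rintro rfl; omega)
  have hE := hout e (by rintro rfl; omega)
  have hsve : 0 < orient (vtx n s) (vtx n v) (vtx n e) :=
    orient_vtx_pos (i := i) (by omega) (by omega)
  set A := orient (vtx n l) (vtx n v) (vtx n r)
  set S := orient (vtx n l) (vtx n r) (vtx n s)
  set E := orient (vtx n l) (vtx n r) (vtx n e)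
  have hAlrv : orient (vtx n l) (vtx n r) (vtx n v) = -A := by
    simp only [A, orient]
    ring
  obtain ⟨t, ht, hbound⟩ : ∃ t > 0, t * (4 * A + S + E) = A :=
    ⟨A / (4 * A + S + E), by positivity, by field_simp⟩
  have htA := mul_pos ht hA
  have htS := mul_nonneg ht.le hS
  have htE := mul_nonneg ht.le hE
  have ht1 : t + t < 1 := by
    by_contra! h
    have := mul_le_mul_of_nonneg_right h hA.le
    linarith
  obtain ⟨z, hz⟩ : ∃ z, z = t • vtx n s + (1 - t - t) • vtx n v + t • vtx n e := ⟨_, rfl⟩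
  have hzo : ∀ p q, orient p q z = t * orient p q (vtx n s) +
      (1 - t - t) * orient p q (vtx n v) + t * orient p q (vtx n e) := fun p q => by
    rw [hz, orient_combination _ _ _ _ _ (by ring)]
  have hzmem : z ∈ ⋃ c ∈ T, cellHull n c := by
    have hsum := (convex_convexHull ℝ (Set.range (vtx n))).sum_mem (t := Finset.univ)
      (w := ![t, 1 - t - t, t]) (z := ![vtx n s, vtx n v, vtx n e])
      (fun k _ => by fin_cases k <;> simp <;> linarith)
      (by simp [Fin.sum_univ_three])
      (fun k _ => subset_convexHull ℝ _ (by fin_cases k <;> simp))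
    rw [hT, hz]
    simpa [Fin.sum_univ_three] using hsum
  obtain ⟨c, hc, hzc⟩ := Set.mem_iUnion₂.mp hzmem
  refine ⟨c, hc, mem_innerVertices.mpr ⟨?_, ?_, ?_⟩⟩
  · by_contra hv
    have := orient_nonneg_of_mem_cellHull
      (fun w hw => hout w (ne_of_mem_of_not_mem hw hv)) hzc
    rw [hzo, hAlrv] at this
    linarith
  · by_contra! hlow
    have := orient_nonneg_of_mem_cellHull (u := vtx n e) (v := vtx n v) (fun w hw => by
      rw [← orient_rotate]
      exact orient_vtx_nonneg (hlow w hw) (by rw [he]; exact hlast w)) hzc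
    rw [hzo] at this
    simp only [orient] at this hsve
    nlinarith
  · by_contra! hhigh
    have := orient_nonneg_of_mem_cellHull (u := vtx n v) (v := vtx n s) (fun w hw => by
      rw [← orient_rotate]
      exact orient_vtx_nonneg (by rw [hs]; exact Nat.zero_le _) (hhigh w hw)) hzc
    rw [hzo] at this
    simp only [orient] at this hsve
    nlinarith

lemma IsDAngulation.isNoncrossingCover {d : ℕ} (hd : 3 ≤ d) {T : Finset (Finset (ZMod n))}
    (hT : IsDAngulation n d T) (i : ZMod n) : IsNoncrossingCover i T where
  not_cross := by
    intro c hc c' hc' hne a ha b hb x hx y hy hax hxb hby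
    obtain ⟨f, u, hf, hfc, hfc'⟩ := exists_separating_cells hd hT hc hc' hne
    have hrel := orient_four_point f (vtx n a) (vtx n x) (vtx n b) (vtx n y)
    have hsum : orient (vtx n x) (vtx n b) (vtx n y) + orient (vtx n a) (vtx n x) (vtx n y) =
        orient (vtx n a) (vtx n b) (vtx n y) + orient (vtx n a) (vtx n x) (vtx n b) := by
      simp only [orient]
      ring
    have hxby := orient_vtx_pos hxb hby
    have haxy := orient_vtx_pos hax (hxb.trans hby)
    have haby := orient_vtx_pos (hax.trans hxb) hby
    have haxb := orient_vtx_pos hax hxb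
    have hfa := hfc a ha
    have hfb := hfc b hb
    have hfx := hfc' x hx
    have hfy := hfc' y hy
    have hpa := mul_nonneg hxby.le (sub_nonneg.mpr hfa)
    have hpb := mul_nonneg haxy.le (sub_nonneg.mpr hfb)
    have hpx := mul_nonneg haby.le (sub_nonneg.mpr hfx)
    have hpy := mul_nonneg haxb.le (sub_nonneg.mpr hfy)
    have hall : orient (vtx n x) (vtx n b) (vtx n y) * (u - f (vtx n a)) +
        orient (vtx n a) (vtx n x) (vtx n y) * (u - f (vtx n b)) +
        orient (vtx n a) (vtx n b) (vtx n y) * (f (vtx n x) - u) +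
        orient (vtx n a) (vtx n x) (vtx n b) * (f (vtx n y) - u) = 0 := by
      linear_combination u * hsum - hrel
    have hea : u - f (vtx n a) = 0 :=
      (mul_eq_zero.mp (by linarith)).resolve_left hxby.ne'
    have heb : u - f (vtx n b) = 0 :=
      (mul_eq_zero.mp (by linarith)).resolve_left haxy.ne'
    have hex : f (vtx n x) - u = 0 :=
      (mul_eq_zero.mp (by linarith)).resolve_left haby.ne'
    exact hf (linear_eq_zero_of_orient_ne_zero haxb.ne' (by linarith) (by linarith))
  not_share := by
    intro c hc c' hc' hne a ha b hb e he ha' hb' he' hab hbe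
    obtain ⟨f, u, hf, hfc, hfc'⟩ := exists_separating_cells hd hT hc hc' hne
    have heq : ∀ v ∈ c, v ∈ c' → f (vtx n v) = u :=
      fun v hv hv' => le_antisymm (hfc v hv) (hfc' v hv')
    refine hf (linear_eq_zero_of_orient_ne_zero (orient_vtx_pos hab hbe).ne' ?_ ?_)
    · rw [heq a ha ha', heq b hb hb']
    · rw [heq a ha ha', heq e he he']
  exists_inner := fun _ h0 h1 => exists_inner_of_cover hT.2.1 h0 h1

namespace IsNoncrossingCover

variable {T : Finset (Finset (ZMod n))} {c c' : Finset (ZMod n)} {v : ZMod n}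

lemma eq_of_mem_innerVertices (H : IsNoncrossingCover i T) (hc : c ∈ T) (hc' : c' ∈ T)
    (hv : v ∈ innerVertices i c) (hv' : v ∈ innerVertices i c') : c = c' := by
  by_contra hne
  obtain ⟨hv, ⟨a, ha, hav⟩, b, hb, hvb⟩ := mem_innerVertices.mp hv
  obtain ⟨hv', ⟨x, hx, hxv⟩, y, hy, hvy⟩ := mem_innerVertices.mp hv'
  have cross := H.not_cross c hc c' hc' hne
  have cross' := H.not_cross c' hc' c hc (Ne.symm hne)
  rcases lt_trichotomy (pos i a) (pos i x) with h | h | h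
  · exact cross a ha v hv x hx y hy h hxv hvy
  · rcases lt_trichotomy (pos i b) (pos i y) with h' | h' | h'
    · exact cross a ha b hb v hv' y hy hav hvb h'
    · obtain rfl := pos_injective i h
      obtain rfl := pos_injective i h'
      exact H.not_share c hc c' hc' hne a ha v hv b hb hx hv' hy hav hvb
    · exact cross' x hx y hy v hv b hb hxv hvy h'
  · exact cross' x hx v hv' a ha b hb h hav hvb

lemma width_lt_width (H : IsNoncrossingCover i T) (hc : c ∈ T) (hc' : c' ∈ T) (hne : c' ≠ c)
    (hv : v ∈ innerVertices i c) (hv' : v ∈ c') : width i c' < width i c := by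
  have hout : v ∉ innerVertices i c' := fun h => hne (H.eq_of_mem_innerVertices hc' hc h hv)
  obtain ⟨hv, ⟨a, ha, hav⟩, b, hb, hvb⟩ := mem_innerVertices.mp hv
  have hle := le_width (i := i) ha hb
  refine lt_of_lt_of_le ((Finset.sup_lt_iff (by rw [Nat.bot_eq_zero]; omega)).mpr ?_) hle
  rintro ⟨x, y⟩ hxy
  obtain ⟨hx, hy⟩ := Finset.mem_product.mp hxy
  dsimp only at hx hy ⊢
  have hlow : ∀ u ∈ c', pos i a ≤ pos i u := fun u hu => by
    by_contra! h
    exact H.not_cross c' hc' c hc hne u hu v hv' a ha b hb h hav hvb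
  have hhigh : ∀ u ∈ c', pos i u ≤ pos i b := fun u hu => by
    by_contra! h
    exact H.not_cross c hc c' hc' hne.symm a ha b hb v hv' u hu hav hvb h
  have := hlow x hx
  have := hhigh y hy
  by_cases hlast : ∃ u ∈ c', pos i v < pos i u
  · have : pos i v ≤ pos i x := by
      by_contra! h
      exact hout (mem_innerVertices.mpr ⟨hv', ⟨x, hx, h⟩, hlast⟩)
    omega
  · push Not at hlast
    have := hlast y hy
    omega

end IsNoncrossingCover

lemma pos_eq_pathLen_add_one {j : ZMod n} (hij : i ≠ j) : pos i j = pathLen n i j + 1 := by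
  have hne : j - i ≠ 0 := sub_ne_zero.mpr hij.symm
  have hpos : 0 < (j - i).val := Nat.pos_of_ne_zero fun h => hne ((ZMod.val_eq_zero _).mp h)
  have hlt := ZMod.val_lt (j - i)
  have heq : j - i - 1 = (((j - i).val - 1 : ℕ) : ZMod n) := by
    rw [Nat.cast_sub hpos]
    simp
  rw [pathLen, heq, ZMod.val_cast_of_lt (by omega), pos]
  omega

lemma pos_path_vertex {j : ZMod n} (hij : i ≠ j) (k : Fin (pathLen n i j)) :
    pos i (i + 1 + ((k : ℕ) : ZMod n)) = k + 1 := by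
  have hj := pos_eq_pathLen_add_one hij
  have hlt : pos i j < n := ZMod.val_lt (j - i)
  have := pos_add_natCast i (k := k + 1) (by omega)
  rwa [Nat.cast_add, Nat.cast_one, add_comm ((k : ℕ) : ZMod n) 1, ← add_assoc] at this

lemma path_vertex_injective {j : ZMod n} (hij : i ≠ j) :
    Function.Injective fun k : Fin (pathLen n i j) => i + 1 + ((k : ℕ) : ZMod n) := by
  intro k l hkl
  have h : (k : ℕ) + 1 = l + 1 := by
    rw [← pos_path_vertex hij k, ← pos_path_vertex hij l]
    exact congrArg (pos i) hkl
  exact Fin.ext (by omega)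

section Path

variable {d : ℕ} {T : Finset (Finset (ZMod n))} {j : ZMod n}
  {q : Fin (pathLen n i j) → {c // c ∈ T}}

/-- Choosing at each vertex a cell for which it is inner gives a `d`-path. -/
lemma isDPath_of_mem_innerVertices (hd : 2 ≤ d) (hcard : ∀ c ∈ T, c.card = d) (hij : i ≠ j)
    (hq : ∀ k, i + 1 + ((k : ℕ) : ZMod n) ∈ innerVertices i (q k : Finset (ZMod n))) :
    IsDPath n d T i j q := by
  refine ⟨fun k => (mem_innerVertices.mp (hq k)).1, fun c hc => ?_⟩
  rw [← hcard c hc, ← card_innerVertices (i := i) (by rw [hcard c hc]; exact hd)]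
  refine Finset.card_le_card_of_injOn (fun k => i + 1 + ((k : ℕ) : ZMod n)) ?_
    (path_vertex_injective hij).injOn
  intro k hk
  have hk : (q k : Finset (ZMod n)) = c := by simpa using hk
  exact hk ▸ hq k

/-- Between two vertices of a common cell there is no other `d`-path. -/
lemma eq_of_isDPath (hd : 2 ≤ d) (hcard : ∀ c ∈ T, c.card = d) (H : IsNoncrossingCover i T)
    (hij : i ≠ j) {c₀ : Finset (ZMod n)} (hc₀ : c₀ ∈ T) (hi : i ∈ c₀) (hj : j ∈ c₀)
    (hq : ∀ k, i + 1 + ((k : ℕ) : ZMod n) ∈ innerVertices i (q k : Finset (ZMod n)))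
    {p : Fin (pathLen n i j) → {c // c ∈ T}} (hp : IsDPath n d T i j p) : p = q := by
  by_contra hpq
  have hlen := pos_eq_pathLen_add_one hij
  have hi0 : pos i i = 0 := by simp [pos]
  obtain ⟨l, hl⟩ := Function.ne_iff.mp hpq
  obtain ⟨k, hk, hmin⟩ := Finset.exists_min_image {k | p k ≠ q k}
    (fun k => width i (q k : Finset (ZMod n))) ⟨l, by simpa using hl⟩
  simp only [Finset.mem_filter, Finset.mem_univ, true_and] at hk hmin
  obtain ⟨c, hc⟩ : ∃ c, c = p k := ⟨_, rfl⟩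
  have hne : (c : Finset (ZMod n)) ≠ q k := fun h => hk (hc ▸ Subtype.ext h)
  have hkc : i + 1 + ((k : ℕ) : ZMod n) ∈ (c : Finset (ZMod n)) := hc ▸ hp.1 k
  have hkpos := pos_path_vertex hij k
  have hwidth := H.width_lt_width (q k).2 c.2 hne (hq k) hkc
  have hcc₀ : (c : Finset (ZMod n)) ≠ c₀ := by
    intro hcc
    have hle : width i (q k : Finset (ZMod n)) ≤ width i c₀ := by
      refine (Finset.sup_le fun x hx => ?_).trans (le_width hi hj)
      have := H.pos_le_of_common_cell hc₀ (q k).2 (hcc ▸ hne.symm) hi hj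
        (mem_innerVertices.mp (hq k)).1 (by omega) (by omega) (Finset.mem_product.mp hx).2
      omega
    rw [hcc] at hwidth
    omega
  have hk_notMem : i + 1 + ((k : ℕ) : ZMod n) ∉ innerVertices i (c : Finset (ZMod n)) :=
    fun h => hne (H.eq_of_mem_innerVertices c.2 (q k).2 h (hq k))
  have hsub : insert (i + 1 + ((k : ℕ) : ZMod n)) (innerVertices i (c : Finset (ZMod n))) ⊆
      (Finset.univ.filter fun l => (p l : Finset (ZMod n)) = c).image
        fun l : Fin (pathLen n i j) => i + 1 + ((l : ℕ) : ZMod n) := by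
    intro v hv
    rw [Finset.mem_image]
    rcases Finset.mem_insert.mp hv with rfl | hv
    · exact ⟨k, by simp [hc], rfl⟩
    obtain ⟨-, ⟨a, -, hav⟩, b, hb, hvb⟩ := mem_innerVertices.mp hv
    have hbj := H.pos_le_of_common_cell hc₀ c.2 hcc₀ hi hj hkc (by omega) (by omega) hb
    obtain ⟨l, hl⟩ : ∃ l : Fin (pathLen n i j), i + 1 + ((l : ℕ) : ZMod n) = v :=
      ⟨⟨pos i v - 1, by omega⟩, pos_injective i (by rw [pos_path_vertex hij]; dsimp only; omega)⟩
    have hql : (q l : Finset (ZMod n)) = c :=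
      H.eq_of_mem_innerVertices (q l).2 c.2 (hl ▸ hq l) hv
    have hpl : p l = q l := by
      by_contra h
      have := hmin l h
      rw [hql] at this
      omega
    exact ⟨l, by simp [hpl, Subtype.ext hql], hl⟩
  have hle := (Finset.card_le_card hsub).trans Finset.card_image_le
  rw [Finset.card_insert_of_notMem hk_notMem,
    card_innerVertices (by rw [hcard c c.2]; exact hd), hcard c c.2] at hle
  have := hp.2 c c.2
  omega

end Path

end Position

/-- If distinct vertices `i` and `j` lie on a common `d`-gon of a `d`-angulation `T`
of the convex `n`-gon, then the number of `d`-paths from `i` to `j` is `1`. -/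
theorem dPathCount_eq_one_of_common_cell (d m n : ℕ) (hd : 3 ≤ d)
    (hn : n = d + m * (d - 2)) (T : Finset (Finset (ZMod n)))
    (hT : IsDAngulation n d T) (i j : ZMod n) (hij : i ≠ j)
    (hc : ∃ c ∈ T, i ∈ c ∧ j ∈ c) :
    dPathCount n d T i j = 1 := by
  have : NeZero n := ⟨by omega⟩
  have H := hT.isNoncrossingCover hd i
  have hlen := pos_eq_pathLen_add_one hij
  have hlt : pos i j < n := ZMod.val_lt (j - i)
  obtain ⟨c₀, hc₀, hi, hj⟩ := hc
  have hex : ∀ k : Fin (pathLen n i j), ∃ c : {c // c ∈ T},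
      i + 1 + ((k : ℕ) : ZMod n) ∈ innerVertices i (c : Finset (ZMod n)) := by
    intro k
    have hk := pos_path_vertex hij k
    obtain ⟨c, hc, hkc⟩ := H.exists_inner (i + 1 + ((k : ℕ) : ZMod n)) (by omega) (by omega)
    exact ⟨⟨c, hc⟩, hkc⟩
  choose q hq using hex
  refine Nat.card_eq_one_iff_exists.mpr
    ⟨⟨q, isDPath_of_mem_innerVertices (by omega) hT.1 hij hq⟩, fun p => Subtype.ext ?_⟩
  exact eq_of_isDPath (by omega) hT.1 H hij hc₀ hi hj hq p.2
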